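/- arXiv:2406.10947 — 2 statements merged into one kernel-verified Lean document; each statement's English description precedes it below -/
import Mathlib

section
/- Let (V, μ) be a nonzero 2-dimensional complex pre-Lie algebra. Then (V, μ) is isomorphic (as an algebra) to exactly one of the following algebras on ℂ² with basis e1, e2: C01: e1·e1 = e1 + e2, e2·e1 = e2; C02: e1·e1 = e1 + e2, e1·e2 = e2; C03: e1·e1 = e2; C04: e2·e1 = e1; C05^α: e1·e1 = e1, e1·e2 = α e2 (α ∈ ℂ); C06^α: e1·e1 = e1, e1·e2 = α e2, e2·e1 = e2 (α ∈ ℂ); C07: e1·e1 = e1, e2·e2 = e2; C08: e1·e1 = e1, e1·e2 = 2 e2, e2·e1 = (1/2) e1 + e2, e2·e2 = e2. -/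
open scoped BigOperators

/-- The underlying vector space `ℂ²`. -/
abbrev V2 : Type := Fin 2 → ℂ

/-- The first standard basis vector of `ℂ²`. -/
noncomputable def e1 : V2 := ![1, 0]

/-- The second standard basis vector of `ℂ²`. -/
noncomputable def e2 : V2 := ![0, 1]

/-- The bilinear multiplication on `ℂ²` with multiplication table `f`,
i.e. the product of the `i`-th and `j`-th basis vectors is `f i j`. -/
noncomputable def bil (f : Fin 2 → Fin 2 → V2) : V2 →ₗ[ℂ] V2 →ₗ[ℂ] V2 :=
  LinearMap.mk₂ ℂ (fun x y => ∑ i : Fin 2, ∑ j : Fin 2, (x i * y j) • f i j)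
    (fun x x' y => by
      simp only [Pi.add_apply, add_mul, add_smul, Finset.sum_add_distrib])
    (fun c x y => by
      simp only [Pi.smul_apply, smul_eq_mul, Finset.smul_sum, smul_smul]
      refine Finset.sum_congr rfl fun i _ => Finset.sum_congr rfl fun j _ => ?_
      congr 1
      ring)
    (fun x y y' => by
      simp only [Pi.add_apply, mul_add, add_smul, Finset.sum_add_distrib])
    (fun c x y => by
      simp only [Pi.smul_apply, smul_eq_mul, Finset.smul_sum, smul_smul]
      refine Finset.sum_congr rfl fun i _ => Finset.sum_congr rfl fun j _ => ?_
      congr 1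
      ring)

/-- `C01 : e1·e1 = e1 + e2, e2·e1 = e2`. -/
noncomputable def C01 : V2 →ₗ[ℂ] V2 →ₗ[ℂ] V2 := bil ![![e1 + e2, 0], ![e2, 0]]

/-- `C02 : e1·e1 = e1 + e2, e1·e2 = e2`. -/
noncomputable def C02 : V2 →ₗ[ℂ] V2 →ₗ[ℂ] V2 := bil ![![e1 + e2, e2], ![0, 0]]

/-- `C03 : e1·e1 = e2`. -/
noncomputable def C03 : V2 →ₗ[ℂ] V2 →ₗ[ℂ] V2 := bil ![![e2, 0], ![0, 0]]

/-- `C04 : e2·e1 = e1`. -/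
noncomputable def C04 : V2 →ₗ[ℂ] V2 →ₗ[ℂ] V2 := bil ![![0, 0], ![e1, 0]]

/-- `C05^α : e1·e1 = e1, e1·e2 = α e2`. -/
noncomputable def C05 (α : ℂ) : V2 →ₗ[ℂ] V2 →ₗ[ℂ] V2 := bil ![![e1, α • e2], ![0, 0]]

/-- `C06^α : e1·e1 = e1, e1·e2 = α e2, e2·e1 = e2`. -/
noncomputable def C06 (α : ℂ) : V2 →ₗ[ℂ] V2 →ₗ[ℂ] V2 := bil ![![e1, α • e2], ![e2, 0]]

/-- `C07 : e1·e1 = e1, e2·e2 = e2`. -/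
noncomputable def C07 : V2 →ₗ[ℂ] V2 →ₗ[ℂ] V2 := bil ![![e1, 0], ![0, e2]]

/-- `C08 : e1·e1 = e1, e1·e2 = 2 e2, e2·e1 = (1/2) e1 + e2, e2·e2 = e2`. -/
noncomputable def C08 : V2 →ₗ[ℂ] V2 →ₗ[ℂ] V2 :=
  bil ![![e1, (2 : ℂ) • e2], ![(1 / 2 : ℂ) • e1 + e2, e2]]

/-- The list of algebras `C01, C02, C03, C04, C07, C08, C05^α (α ∈ ℂ), C06^α (α ∈ ℂ)`,
indexed by `Fin 6 ⊕ ℂ ⊕ ℂ`. -/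
noncomputable def mulOf : Fin 6 ⊕ ℂ ⊕ ℂ → (V2 →ₗ[ℂ] V2 →ₗ[ℂ] V2) :=
  Sum.elim ![C01, C02, C03, C04, C07, C08] (Sum.elim C05 C06)

/-- A linear automorphism of `ℂ²` in matrix form; `t` is the inverse of its determinant. -/
lemma exists_matrix_of_equiv (σ : V2 ≃ₗ[ℂ] V2) :
    ∃ p q r s t : ℂ, (p * s - q * r) * t = 1 ∧
      ∀ a b : ℂ, σ ![a, b] = ![p * a + r * b, q * a + s * b] := by
  have key : ∀ (τ : V2 ≃ₗ[ℂ] V2) (a b : ℂ), τ ![a, b] =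
      ![τ e1 0 * a + τ e2 0 * b, τ e1 1 * a + τ e2 1 * b] := by
    intro τ a b
    have h : (![a, b] : V2) = a • e1 + b • e2 := by
      ext i; fin_cases i <;> simp [e1, e2]
    rw [h, map_add, map_smul, map_smul]
    ext i; fin_cases i <;> simp [mul_comm]
  refine ⟨σ e1 0, σ e1 1, σ e2 0, σ e2 1,
    σ.symm e1 0 * σ.symm e2 1 - σ.symm e1 1 * σ.symm e2 0, ?_, key σ⟩
  have h1 : σ.symm (σ ![1, 0]) = ![1, 0] := σ.symm_apply_apply _
  have h2 : σ.symm (σ ![0, 1]) = ![0, 1] := σ.symm_apply_apply _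
  rw [key σ, key σ.symm] at h1 h2
  have h10 := congrFun h1 0
  have h11 := congrFun h1 1
  have h20 := congrFun h2 0
  have h21 := congrFun h2 1
  simp at h10 h11 h20 h21
  grind

lemma bil_apply_vec (f : Fin 2 → Fin 2 → V2) (a b c d : ℂ) :
    bil f ![a, b] ![c, d] = (a * c) • f 0 0 + (a * d) • f 0 1 + (b * c) • f 1 0
      + (b * d) • f 1 1 := by
  simp [bil, Fin.sum_univ_two, add_assoc]

set_option maxHeartbeats 4000000 in
/-- Distinct algebras in the list `mulOf` are not isomorphic. -/
lemma eq_of_mulOf_equiv {i j : Fin 6 ⊕ ℂ ⊕ ℂ} (σ : V2 ≃ₗ[ℂ] V2)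
    (hσ : ∀ x y : V2, σ (mulOf i x y) = mulOf j (σ x) (σ y)) : i = j := by
  obtain ⟨p, q, r, s, t, ht, hm⟩ := exists_matrix_of_equiv σ
  have h11 := hσ ![1, 0] ![1, 0]
  have h12 := hσ ![1, 0] ![0, 1]
  have h21 := hσ ![0, 1] ![1, 0]
  have h22 := hσ ![0, 1] ![0, 1]
  clear hσ
  simp only [hm] at h11 h12 h21 h22
  rcases i with i | α | α <;> rcases j with j | β | β <;>
    (try fin_cases i) <;> (try fin_cases j) <;>
    simp [mulOf, C01, C02, C03, C04, C05, C06, C07, C08, bil_apply_vec, e1, e2, hm,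
      funext_iff, Fin.forall_fin_two] at h11 h12 h21 h22 ⊢ <;>
    clear hm <;> grind

/-- A basis whose multiplication table agrees with that of `f` gives an isomorphism onto `bil f`. -/
lemma exists_equiv_of_table {V : Type*} [AddCommGroup V] [Module ℂ V]
    (hdim : Module.finrank ℂ V = 2) {μ : V →ₗ[ℂ] V →ₗ[ℂ] V} {f : Fin 2 → Fin 2 → V2} {u v : V}
    (h : LinearIndependent ℂ ![u, v])
    (h11 : μ u u = f 0 0 0 • u + f 0 0 1 • v) (h12 : μ u v = f 0 1 0 • u + f 0 1 1 • v)
    (h21 : μ v u = f 1 0 0 • u + f 1 0 1 • v) (h22 : μ v v = f 1 1 0 • u + f 1 1 1 • v) :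
    ∃ φ : V ≃ₗ[ℂ] V2, ∀ x y : V, φ (μ x y) = bil f (φ x) (φ y) := by
  let b := basisOfLinearIndependentOfCardEqFinrank h (by simp [hdim])
  have hb : ⇑b = ![u, v] := coe_basisOfLinearIndependentOfCardEqFinrank h _
  have hu : b.equivFun u = ![1, 0] := by
    have : u = b 0 := by simp [hb]
    rw [this]; ext i; fin_cases i <;> simp
  have hv : b.equivFun v = ![0, 1] := by
    have : v = b 1 := by simp [hb]
    rw [this]; ext i; fin_cases i <;> simp
  refine ⟨b.equivFun, fun x y => ?_⟩
  have key : μ.compr₂ b.equivFun.toLinearMap =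
      (bil f).compl₁₂ b.equivFun.toLinearMap b.equivFun.toLinearMap := by
    refine b.ext fun i => b.ext fun j => ?_
    simp only [LinearMap.compr₂_apply, LinearMap.compl₁₂_apply, LinearEquiv.coe_coe, hb]
    fin_cases i <;> fin_cases j <;>
      simp only [Fin.zero_eta, Fin.mk_one, Matrix.cons_val_zero, Matrix.cons_val_one, h11, h12,
        h21, h22, map_add, map_smul, hu, hv, bil_apply_vec] <;>
      ext k <;> fin_cases k <;> simp
  exact LinearMap.congr_fun₂ key x y

lemma linearIndependent_pair_linear_combination {V : Type*} [AddCommGroup V] [Module ℂ V] {x y : V}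
    (h : LinearIndependent ℂ ![x, y]) {a b c d : ℂ} (hd : a * d - b * c ≠ 0) :
    LinearIndependent ℂ ![a • x + b • y, c • x + d • y] :=
  (LinearIndependent.pair_add_smul_add_smul_iff ..).2 ⟨h, sub_ne_zero.1 hd⟩

/-- `μ` is isomorphic to one of the algebras in the list `mulOf`. -/
def IsListed {V : Type*} [AddCommGroup V] [Module ℂ V] (μ : V →ₗ[ℂ] V →ₗ[ℂ] V) : Prop :=
  ∃ i : Fin 6 ⊕ ℂ ⊕ ℂ, ∃ φ : V ≃ₗ[ℂ] V2, ∀ x y : V, φ (μ x y) = mulOf i (φ x) (φ y)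

section Existence

variable {V : Type*} [AddCommGroup V] [Module ℂ V] {μ : V →ₗ[ℂ] V →ₗ[ℂ] V} {x y : V}

/-- Recognition of a listed algebra from a change of basis `u = a x + b y`, `v = c x + d y`. -/
lemma isListed_of_change_of_basis (hdim : Module.finrank ℂ V = 2)
    (h : LinearIndependent ℂ ![x, y]) (i : Fin 6 ⊕ ℂ ⊕ ℂ) {f : Fin 2 → Fin 2 → V2}
    (hf : mulOf i = bil f) (a b c d : ℂ) (hd : a * d - b * c ≠ 0) {u v : V}
    (hu : a • x + b • y = u) (hv : c • x + d • y = v)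
    (h11 : μ u u = f 0 0 0 • u + f 0 0 1 • v) (h12 : μ u v = f 0 1 0 • u + f 0 1 1 • v)
    (h21 : μ v u = f 1 0 0 • u + f 1 0 1 • v) (h22 : μ v v = f 1 1 0 • u + f 1 1 1 • v) :
    IsListed μ := by
  refine ⟨i, ?_⟩
  rw [hf]
  refine exists_equiv_of_table hdim ?_ h11 h12 h21 h22
  rw [← hu, ← hv]
  exact linearIndependent_pair_linear_combination h hd

/-- Algebras with `x² = 0`, `xy = 0`, `yx = -x`. -/
lemma isListed_of_right_annihilated (hdim : Module.finrank ℂ V = 2)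
    (h : LinearIndependent ℂ ![x, y]) {e f : ℂ}
    (hxx : μ x x = 0) (hxy : μ x y = 0) (hyx : μ y x = -x) (hyy : μ y y = e • x + f • y) :
    IsListed μ := by
  by_cases hf1 : f = -1
  · subst hf1
    by_cases he : e = 0
    · subst he
      refine isListed_of_change_of_basis hdim h (Sum.inr (Sum.inl 1)) rfl 0 (-1) 1 0 (by simp)
        rfl rfl ?_ ?_ ?_ ?_ <;> simp [hxx, hxy, hyx, hyy, e1, e2]
    · refine isListed_of_change_of_basis hdim h (Sum.inl 1) rfl 0 (-1) e 0 (by simpa) rfl rfl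
        ?_ ?_ ?_ ?_ <;> simp [hxx, hxy, hyx, hyy, e1, e2] <;> module
  · have hf1' : 1 + f ≠ 0 := fun h0 => hf1 (by linear_combination h0)
    by_cases hf : f = 0
    · subst hf
      refine isListed_of_change_of_basis hdim h (Sum.inl 3) rfl 1 0 (-e) (-1) (by simp) rfl rfl
        ?_ ?_ ?_ ?_ <;> simp [hxx, hxy, hyx, hyy, e1, e2]
    · refine isListed_of_change_of_basis hdim h (Sum.inr (Sum.inl (-f⁻¹))) rfl
        (f⁻¹ * e / (1 + f)) f⁻¹ 1 0 (by simpa) rfl rfl ?_ ?_ ?_ ?_ <;>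
        simp [hxx, hxy, hyx, hyy, e1, e2] <;> match_scalars <;> field_simp <;> ring

/-- Algebras with `x² = 0`, `xy = cx`, `yx = (c - 1)x`, `y² = ex + cy`, `c ≠ 0`. -/
lemma isListed_of_right_unit (hdim : Module.finrank ℂ V = 2)
    (h : LinearIndependent ℂ ![x, y]) {c e : ℂ} (hc : c ≠ 0)
    (hxx : μ x x = 0) (hxy : μ x y = c • x) (hyx : μ y x = (c - 1) • x)
    (hyy : μ y y = e • x + c • y) :
    IsListed μ := by
  by_cases hc1 : c = 1
  · subst hc1
    by_cases he : e = 0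
    · subst he
      refine isListed_of_change_of_basis hdim h (Sum.inr (Sum.inr 0)) rfl 0 1 1 0 (by simp) rfl rfl
        ?_ ?_ ?_ ?_ <;> simp [hxx, hxy, hyx, hyy, e1, e2]
    · refine isListed_of_change_of_basis hdim h (Sum.inl 0) rfl 0 1 e 0 (by simpa) rfl rfl
        ?_ ?_ ?_ ?_ <;> simp [hxx, hxy, hyx, hyy, e1, e2, add_comm]
  · have hc1' : c - 1 ≠ 0 := sub_ne_zero.2 hc1
    refine isListed_of_change_of_basis hdim h (Sum.inr (Sum.inr ((c - 1) / c))) rfl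
      (-e / (c - 1) / c) c⁻¹ 1 0 (by simpa) rfl rfl ?_ ?_ ?_ ?_ <;>
      simp [hxx, hxy, hyx, hyy, e1, e2] <;> match_scalars <;> field_simp <;> ring

/-- Algebras with `x² = by`, `xy = 0`, `yx = -x`, `y² = -2y`, `b ≠ 0`. -/
lemma isListed_of_simple (hdim : Module.finrank ℂ V = 2)
    (h : LinearIndependent ℂ ![x, y]) {b : ℂ} (hb : b ≠ 0)
    (hxx : μ x x = b • y) (hxy : μ x y = 0) (hyx : μ y x = -x) (hyy : μ y y = (-2 : ℂ) • y) :
    IsListed μ := by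
  obtain ⟨s, hs⟩ := IsAlgClosed.exists_pow_nat_eq (b⁻¹) (n := 2) two_pos
  have hs0 : s ≠ 0 := by
    rintro rfl
    simp at hs
    exact hb hs.symm
  have hb' : b = (s ^ 2)⁻¹ := by rw [hs, inv_inv]
  subst hb'
  refine isListed_of_change_of_basis hdim h (Sum.inl 5) rfl (-s) (-1) 0 (-(1 / 2)) (by simpa)
    rfl rfl ?_ ?_ ?_ ?_ <;> simp [hxx, hxy, hyx, hyy, e1, e2] <;> match_scalars <;> field_simp <;> ring

lemma eq_and_eq_of_linearIndependent (h : LinearIndependent ℂ ![x, y]) {a b c d : ℂ}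
    (e : a • x + b • y = c • x + d • y) : a = c ∧ b = d := by
  have := LinearIndependent.pair_iff.1 h (a - c) (b - d) (by
    rw [sub_smul, sub_smul, ← sub_eq_zero.2 e]; abel)
  exact ⟨sub_eq_zero.1 this.1, sub_eq_zero.1 this.2⟩

/-- Pre-Lie algebras with a basis such that `xy - yx = x`. -/
lemma isListed_of_commutator (hdim : Module.finrank ℂ V = 2)
    (hpl : ∀ x y z : V, μ (μ x y) z - μ x (μ y z) = μ (μ y x) z - μ y (μ x z))
    (h : LinearIndependent ℂ ![x, y]) {a b c d e f : ℂ}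
    (hxx : μ x x = a • x + b • y) (hxy : μ x y = c • x + d • y)
    (hyx : μ y x = (c - 1) • x + d • y) (hyy : μ y y = e • x + f • y) : IsListed μ := by
  have h1 := hpl x y x
  have h2 := hpl x y y
  simp only [hxx, hxy, hyx, hyy, map_add, map_smul, LinearMap.add_apply, LinearMap.smul_apply]
    at h1 h2
  have h1' : (a - c * d + e * b) • x + (b - b * (c - 1) - d ^ 2 + a * d + b * f) • y
      = (0 : ℂ) • x + (0 : ℂ) • y := by
    linear_combination (norm := module) h1
  have h2' : (c - a * e - c * f + c * (c - 1) + d * e) • x + (d - b * e + c * d) • y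
      = (0 : ℂ) • x + (0 : ℂ) • y := by
    linear_combination (norm := module) h2
  obtain ⟨p1, p2⟩ := eq_and_eq_of_linearIndependent h h1'
  obtain ⟨p3, p4⟩ := eq_and_eq_of_linearIndependent h h2'
  have hd : d = -a := by linear_combination p1 + p4
  subst hd
  by_cases hb : b = 0
  · subst hb
    have ha : a = 0 := by
      have : a ^ 2 = 0 := by linear_combination -p2 / 2
      simpa using this
    subst ha
    by_cases hc : c = 0
    · subst hc
      exact isListed_of_right_annihilated hdim h (by simpa using hxx) (by simpa using hxy)
        (by simpa using hyx) hyy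
    · have hf : f = c := mul_left_cancel₀ hc (by linear_combination -p3)
      subst hf
      exact isListed_of_right_unit hdim h hc (by simpa using hxx) (by simpa using hxy)
        (by simpa using hyx) hyy
  · have hc : c = -a ^ 2 / b := by
      field_simp
      grind
    have hf : f = -2 - c := by
      apply mul_left_cancel₀ hb
      rw [hc] at p2 ⊢
      field_simp at p2 ⊢
      linear_combination p2
    have he : e = -(a + c * a) / b := by
      field_simp
      linear_combination p1
    have h' := linearIndependent_pair_linear_combination h (a := 1) (b := 0) (c := a / b) (d := 1)
      (by simp)
    rw [one_smul, zero_smul, add_zero, one_smul] at h'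
    subst he hf hc
    refine isListed_of_simple hdim h' hb ?_ ?_ ?_ ?_ <;>
      simp [hxx, hxy, hyx, hyy] <;> match_scalars <;> field_simp <;> ring

/-- Commutative associative algebras with a basis of the form `x, x²`. -/
lemma isListed_of_generator (hdim : Module.finrank ℂ V = 2)
    (h : LinearIndependent ℂ ![x, y]) {p q : ℂ} (hcomm : ∀ x y, μ x y = μ y x)
    (hass : ∀ x y z, μ (μ x y) z = μ x (μ y z))
    (hxx : μ x x = y) (hxy : μ x y = p • x + q • y) : IsListed μ := by
  have hyx : μ y x = p • x + q • y := by rw [hcomm, hxy]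
  have hyy : μ y y = (p * q) • x + (p + q ^ 2) • y := by
    have := hass x x y
    rw [hxx, hxy, map_add, map_smul, map_smul, hxx, hxy] at this
    rw [this]
    module
  obtain ⟨r, hr⟩ := IsAlgClosed.exists_pow_nat_eq (q ^ 2 + 4 * p) (n := 2) two_pos
  obtain ⟨s, rfl⟩ : ∃ s, q = r + 2 * s := ⟨(q - r) / 2, by ring⟩
  obtain rfl : p = -(s * (r + s)) := by linear_combination -hr / 4
  clear hr
  by_cases hr : r = 0
  · subst hr
    by_cases hs : s = 0
    · subst hs
      refine isListed_of_change_of_basis hdim h (Sum.inl 2) rfl 1 0 0 1 (by simp) rfl rfl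
        ?_ ?_ ?_ ?_ <;> simp [hxx, hxy, hyx, hyy, e1, e2]
    · refine isListed_of_change_of_basis hdim h (Sum.inr (Sum.inr 1)) rfl (2 / s) (-1 / s ^ 2) (-s) 1
        (by field_simp; norm_num; exact hs) rfl rfl ?_ ?_ ?_ ?_ <;> simp [hxx, hxy, hyx, hyy, e1, e2] <;>
        match_scalars <;> field_simp <;> ring
  · by_cases hs : s = 0
    · subst hs
      refine isListed_of_change_of_basis hdim h (Sum.inr (Sum.inl 0)) rfl 0 (1 / r ^ 2) (-r) 1
        (by simpa) rfl rfl ?_ ?_ ?_ ?_ <;> simp [hxx, hxy, hyx, hyy, e1, e2] <;>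
        match_scalars <;> field_simp <;> ring
    · by_cases hrs : r + s = 0
      · obtain rfl : s = -r := by linear_combination hrs
        refine isListed_of_change_of_basis hdim h (Sum.inr (Sum.inl 0)) rfl 0 (1 / r ^ 2) r 1
          (by simpa) rfl rfl ?_ ?_ ?_ ?_ <;> simp [hxx, hxy, hyx, hyy, e1, e2] <;>
          match_scalars <;> field_simp <;> ring
      · have hd : -s / ((r + s) * r) * (-1 / (s * r)) - 1 / ((r + s) * r) * ((r + s) / (s * r)) ≠ 0 := by
          rw [show -s / ((r + s) * r) * (-1 / (s * r)) - 1 / ((r + s) * r) * ((r + s) / (s * r))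
            = -1 / ((r + s) * s * r) by field_simp; ring]
          simp [hr, hs, hrs]
        refine isListed_of_change_of_basis hdim h (Sum.inl 4) rfl (-s / ((r + s) * r))
          (1 / ((r + s) * r)) ((r + s) / (s * r)) (-1 / (s * r))
          hd rfl rfl ?_ ?_ ?_ ?_ <;>
          simp [hxx, hxy, hyx, hyy, e1, e2] <;> match_scalars <;> field_simp <;> ring

lemma exists_smul_add_smul_eq (hdim : Module.finrank ℂ V = 2)
    (h : LinearIndependent ℂ ![x, y]) (z : V) : ∃ a b : ℂ, z = a • x + b • y := by
  have : Module.Finite ℂ V := Module.finite_of_finrank_pos (by simp [hdim])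
  have hs := h.span_eq_top_of_card_eq_finrank' (by simp [hdim])
  have hz : z ∈ Submodule.span ℂ (Set.range ![x, y]) := hs ▸ Submodule.mem_top
  simp only [Matrix.range_cons, Matrix.range_empty, Set.union_empty, Set.singleton_union] at hz
  obtain ⟨a, b, hab⟩ := Submodule.mem_span_pair.1 hz
  exact ⟨a, b, hab.symm⟩

lemma isListed_of_linearIndependent_sq (hdim : Module.finrank ℂ V = 2)
    (hcomm : ∀ x y, μ x y = μ y x) (hass : ∀ x y z, μ (μ x y) z = μ x (μ y z))
    (h : LinearIndependent ℂ ![x, μ x x]) : IsListed μ := by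
  obtain ⟨p, q, hpq⟩ := exists_smul_add_smul_eq hdim h (μ x (μ x x))
  exact isListed_of_generator hdim h hcomm hass rfl hpq

lemma isListed_of_comm (hdim : Module.finrank ℂ V = 2) (hne : μ ≠ 0)
    (hcomm : ∀ x y, μ x y = μ y x) (hass : ∀ x y z, μ (μ x y) z = μ x (μ y z))
    (h : LinearIndependent ℂ ![x, y]) : IsListed μ := by
  by_contra hnot
  have hdep : ∀ a b c d : ℂ, μ (a • x + b • y) (a • x + b • y) = c • x + d • y →
      a * d - b * c = 0 := by
    intro a b c d hsq
    by_contra hd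
    refine hnot (isListed_of_linearIndependent_sq hdim hcomm hass (x := a • x + b • y) ?_)
    rw [hsq]
    exact linearIndependent_pair_linear_combination h hd
  obtain ⟨a, b, hxx⟩ := exists_smul_add_smul_eq hdim h (μ x x)
  obtain ⟨c, d, hxy⟩ := exists_smul_add_smul_eq hdim h (μ x y)
  obtain ⟨e, f, hyy⟩ := exists_smul_add_smul_eq hdim h (μ y y)
  have hyx : μ y x = c • x + d • y := by rw [hcomm, hxy]
  have q1 := hdep 1 0 a b (by simpa using hxx)
  have q2 := hdep 0 1 e f (by simpa using hyy)
  have q3 := hdep 1 1 (a + 2 * c + e) (b + 2 * d + f) (by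
    simp [hxx, hxy, hyx, hyy]; module)
  have q4 := hdep 1 (-1) (a - 2 * c + e) (b - 2 * d + f) (by
    simp [hxx, hxy, hyx, hyy]; module)
  have h1 := hass x x y
  simp only [hxx, hxy, hyy, map_add, map_smul, LinearMap.add_apply, LinearMap.smul_apply] at h1
  have h1' : (a * c + b * e) • x + (a * d + b * f) • y
      = (c * a + d * c) • x + (c * b + d * d) • y := by
    linear_combination (norm := module) h1
  obtain ⟨q5, q6⟩ := eq_and_eq_of_linearIndependent h h1'
  have h2 := hass x y y
  simp only [hxx, hxy, hyy, map_add, map_smul, LinearMap.add_apply, LinearMap.smul_apply] at h2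
  have h2' : (c * c + d * e) • x + (c * d + d * f) • y
      = (e * a + f * c) • x + (e * b + f * d) • y := by
    linear_combination (norm := module) h2
  obtain ⟨q7, q8⟩ := eq_and_eq_of_linearIndependent h h2'
  have hb : b = 0 := by linear_combination q1
  have he : e = 0 := by linear_combination -q2
  subst hb he
  have ha : a = 2 * d := by linear_combination (q4 - q3) / 2
  have hf : f = 2 * c := by linear_combination (q3 + q4) / 2
  have hd : d = 0 := by
    have : d ^ 2 = 0 := by rw [ha] at q6; linear_combination q6
    simpa using this
  have hc : c = 0 := by
    have : c ^ 2 = 0 := by rw [hf] at q7; linear_combination -q7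
    simpa using this
  subst hd hc
  simp only [ha, hf, mul_zero, zero_smul, add_zero] at hxx hxy hyx hyy
  refine hne (LinearMap.ext fun u => LinearMap.ext fun v => ?_)
  obtain ⟨a, b, rfl⟩ := exists_smul_add_smul_eq hdim h u
  obtain ⟨c, d, rfl⟩ := exists_smul_add_smul_eq hdim h v
  simp [hxx, hxy, hyx, hyy]

theorem isListed_of_preLie (hdim : Module.finrank ℂ V = 2) (hne : μ ≠ 0)
    (hpl : ∀ x y z : V, μ (μ x y) z - μ x (μ y z) = μ (μ y x) z - μ y (μ x z)) :
    IsListed μ := by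
  have : Module.Finite ℂ V := Module.finite_of_finrank_pos (by simp [hdim])
  let b := Module.finBasisOfFinrankEq ℂ V hdim
  have hli : LinearIndependent ℂ ![b 0, b 1] := by
    convert b.linearIndependent using 1
    ext i; fin_cases i <;> rfl
  by_cases hcomm : ∀ x y, μ x y = μ y x
  · refine isListed_of_comm hdim hne hcomm (fun x y z => ?_) hli
    have h1 := hpl x z y
    have h2 : μ x (μ z y) = μ z (μ x y) := by
      rw [hcomm z x] at h1
      exact sub_right_injective h1
    rw [hcomm (μ x y) z, ← h2, hcomm z y]
  · push Not at hcomm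
    obtain ⟨u, v, huv⟩ := hcomm
    generalize b 0 = x at hli
    generalize b 1 = y at hli
    obtain ⟨p, q, hw⟩ := exists_smul_add_smul_eq hdim hli (μ x y - μ y x)
    have hw0 : p ≠ 0 ∨ q ≠ 0 := by
      by_contra! h0
      rw [h0.1, h0.2, zero_smul, zero_smul, add_zero, sub_eq_zero] at hw
      obtain ⟨a, b, rfl⟩ := exists_smul_add_smul_eq hdim hli u
      obtain ⟨c, d, rfl⟩ := exists_smul_add_smul_eq hdim hli v
      refine huv ?_
      simp [hw]
      module
    obtain ⟨r, s, hrs⟩ : ∃ r s : ℂ, p * s - q * r = 1 := by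
      rcases hw0 with hp | hq
      · exact ⟨0, p⁻¹, by field_simp; simp⟩
      · exact ⟨-q⁻¹, 0, by field_simp; simp⟩
    have h' := linearIndependent_pair_linear_combination hli (a := p) (b := q) (c := r) (d := s)
      (by rw [hrs]; exact one_ne_zero)
    have hcom : μ (p • x + q • y) (r • x + s • y) - μ (r • x + s • y) (p • x + q • y)
        = p • x + q • y := by
      calc _ = (p * s - q * r) • (μ x y - μ y x) := by simp; module
        _ = _ := by rw [hrs, hw, one_smul]
    generalize p • x + q • y = X at h' hcom
    generalize r • x + s • y = Y at h' hcom
    obtain ⟨a, b, hxx⟩ := exists_smul_add_smul_eq hdim h' (μ X X)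
    obtain ⟨c, d, hxy⟩ := exists_smul_add_smul_eq hdim h' (μ X Y)
    obtain ⟨e, f, hyy⟩ := exists_smul_add_smul_eq hdim h' (μ Y Y)
    refine isListed_of_commutator hdim hpl h' hxx hxy ?_ hyy
    rw [← sub_sub_cancel (μ X Y) (μ Y X), hcom, hxy]
    module

end Existence

/-- Any nonzero 2-dimensional complex pre-Lie algebra is isomorphic to exactly one of
`C01, C02, C03, C04, C05^α, C06^α, C07, C08`. -/
theorem classification_of_two_dimensional_preLie_algebras
    (V : Type) [AddCommGroup V] [Module ℂ V]
    (hdim : Module.finrank ℂ V = 2)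
    (μ : V →ₗ[ℂ] V →ₗ[ℂ] V) (hne : μ ≠ 0)
    (hpl : ∀ x y z : V, μ (μ x y) z - μ x (μ y z) = μ (μ y x) z - μ y (μ x z)) :
    ∃! i : Fin 6 ⊕ ℂ ⊕ ℂ, ∃ φ : V ≃ₗ[ℂ] V2,
      ∀ x y : V, φ (μ x y) = mulOf i (φ x) (φ y) := by
  obtain ⟨i, φ, hφ⟩ := isListed_of_preLie hdim hne hpl
  refine ⟨i, ⟨φ, hφ⟩, ?_⟩
  rintro j ⟨ψ, hψ⟩
  refine eq_of_mulOf_equiv (ψ.symm.trans φ) fun x y => ?_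
  obtain ⟨x, rfl⟩ := ψ.surjective x
  obtain ⟨y, rfl⟩ := ψ.surjective y
  simp [← hψ, hφ]
end

section
/- Let μ be the pre-Lie multiplication C03 on ℂ²: e1·e1 = e2 (all other products of basis vectors zero). A linear bijection φ : ℂ² → ℂ² satisfies φ(μ(x,y)) = μ(φ(x),φ(y)) for all x,y if and only if there exist ξ ∈ ℂ with ξ ≠ 0 and ν ∈ ℂ such that φ(e1) = ξ e1 + ν e2 and φ(e2) = ξ² e2. -/
open scoped BigOperators

/-- A bilinear map is a pre-Lie multiplication if it satisfies the (right)
pre-Lie identity. -/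
def IsPreLie {V : Type*} [AddCommGroup V] [Module ℂ V]
    (μ : V →ₗ[ℂ] V →ₗ[ℂ] V) : Prop :=
  ∀ x y z : V, μ (μ x y) z - μ x (μ y z) = μ (μ y x) z - μ y (μ x z)

/-- `(V, μ, ν)` is a compatible pre-Lie algebra: `μ`, `ν` and `μ + ν` are all
pre-Lie multiplications. -/
def IsCompatPreLie {V : Type*} [AddCommGroup V] [Module ℂ V]
    (μ ν : V →ₗ[ℂ] V →ₗ[ℂ] V) : Prop :=
  IsPreLie μ ∧ IsPreLie ν ∧ IsPreLie (μ + ν)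

/-- Isomorphism of the two-multiplication algebras `(ℂ², μ, ν)` and `(ℂ², μ', ν')`. -/
def CompatIso (μ ν μ' ν' : V2 →ₗ[ℂ] V2 →ₗ[ℂ] V2) : Prop :=
  ∃ φ : V2 ≃ₗ[ℂ] V2, (∀ x y : V2, φ (μ x y) = μ' (φ x) (φ y)) ∧
    (∀ x y : V2, φ (ν x y) = ν' (φ x) (φ y))

/-- The second multiplication of `C09^{α,β}`: `e1∗e1 = α e1, e1∗e2 = β e2, e2∗e1 = α e2`. -/
noncomputable def C09s (α β : ℂ) : V2 →ₗ[ℂ] V2 →ₗ[ℂ] V2 :=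
  bil ![![α • e1, β • e2], ![α • e2, 0]]

/-- The second multiplication of `C10^{α,β}`: `e1∗e1 = α e1 + β e2, e2∗e1 = α e2`. -/
noncomputable def C10s (α β : ℂ) : V2 →ₗ[ℂ] V2 →ₗ[ℂ] V2 :=
  bil ![![α • e1 + β • e2, 0], ![α • e2, 0]]

/-- The second multiplication of `C11^{α,β}`: `e1∗e1 = α e1, e1∗e2 = β e2`. -/
noncomputable def C11s (α β : ℂ) : V2 →ₗ[ℂ] V2 →ₗ[ℂ] V2 :=
  bil ![![α • e1, β • e2], ![0, 0]]

/-- The second multiplication of `C12^{α,β}`: `e1∗e1 = α e1 + β e2, e1∗e2 = α e2`. -/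
noncomputable def C12s (α β : ℂ) : V2 →ₗ[ℂ] V2 →ₗ[ℂ] V2 :=
  bil ![![α • e1 + β • e2, α • e2], ![0, 0]]

/-- The second multiplication of `C13^α`: `e1∗e1 = α e1, e1∗e2 = e2, e2∗e1 = α e2`. -/
noncomputable def C13s (α : ℂ) : V2 →ₗ[ℂ] V2 →ₗ[ℂ] V2 :=
  bil ![![α • e1, e2], ![α • e2, 0]]

/-- The second multiplication of `C14^α`: `e1∗e1 = e1 + α e2, e2∗e1 = e2`. -/
noncomputable def C14s (α : ℂ) : V2 →ₗ[ℂ] V2 →ₗ[ℂ] V2 :=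
  bil ![![e1 + α • e2, 0], ![e2, 0]]

/-- The second multiplication of `C15^α`: `e1∗e1 = α e2`. -/
noncomputable def C15s (α : ℂ) : V2 →ₗ[ℂ] V2 →ₗ[ℂ] V2 :=
  bil ![![α • e2, 0], ![0, 0]]

/-- The second multiplication of `C16^α`: `e1∗e1 = e1, e1∗e2 = α e2`. -/
noncomputable def C16s (α : ℂ) : V2 →ₗ[ℂ] V2 →ₗ[ℂ] V2 :=
  bil ![![e1, α • e2], ![0, 0]]

/-- The second multiplication of `C17^α`: `e1∗e1 = e1 + α e2, e1∗e2 = e2`. -/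
noncomputable def C17s (α : ℂ) : V2 →ₗ[ℂ] V2 →ₗ[ℂ] V2 :=
  bil ![![e1 + α • e2, e2], ![0, 0]]

/-- The second multiplication of `C18^α`: `e1∗e1 = α e2, e1∗e2 = e1, e2∗e1 = e1, e2∗e2 = e2`. -/
noncomputable def C18s (α : ℂ) : V2 →ₗ[ℂ] V2 →ₗ[ℂ] V2 :=
  bil ![![α • e2, e1], ![e1, e2]]

/-- The second multiplication of `C19^α`: `e1∗e1 = α e2, e2∗e1 = e1, e2∗e2 = 2 e2`. -/
noncomputable def C19s (α : ℂ) : V2 →ₗ[ℂ] V2 →ₗ[ℂ] V2 :=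
  bil ![![α • e2, 0], ![e1, (2 : ℂ) • e2]]

/-- The second multiplication of `C20^{α,β}`: `e2∗e1 = α e1, e2∗e2 = e1 + β e2`. -/
noncomputable def C20s (α β : ℂ) : V2 →ₗ[ℂ] V2 →ₗ[ℂ] V2 :=
  bil ![![0, 0], ![α • e1, e1 + β • e2]]

/-- The second multiplication of `C21^{α,β}`: `e2∗e1 = α e1, e2∗e2 = β e2`. -/
noncomputable def C21s (α β : ℂ) : V2 →ₗ[ℂ] V2 →ₗ[ℂ] V2 :=
  bil ![![0, 0], ![α • e1, β • e2]]

/-- The second multiplication of `C22^{α,β}`: `e1∗e2 = α e1, e2∗e1 = β e1, e2∗e2 = e1 + α e2`. -/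
noncomputable def C22s (α β : ℂ) : V2 →ₗ[ℂ] V2 →ₗ[ℂ] V2 :=
  bil ![![0, α • e1], ![β • e1, e1 + α • e2]]

/-- The second multiplication of `C23^{α,β}`: `e1∗e2 = α e1, e2∗e1 = β e1, e2∗e2 = α e2`. -/
noncomputable def C23s (α β : ℂ) : V2 →ₗ[ℂ] V2 →ₗ[ℂ] V2 :=
  bil ![![0, α • e1], ![β • e1, α • e2]]

/-- The second multiplication of `C24^{α,β,γ}`: `e1∗e1 = β e1 + e2, e1∗e2 = γ e2`. -/
noncomputable def C24s (β γ : ℂ) : V2 →ₗ[ℂ] V2 →ₗ[ℂ] V2 :=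
  bil ![![β • e1 + e2, γ • e2], ![0, 0]]

/-- The second multiplication of `C25^{α,β,γ}`: `e1∗e1 = β e1, e1∗e2 = γ e2`. -/
noncomputable def C25s (β γ : ℂ) : V2 →ₗ[ℂ] V2 →ₗ[ℂ] V2 :=
  bil ![![β • e1, γ • e2], ![0, 0]]

/-- The second multiplication of `C29^α`: `e1∗e1 = α e1, e2∗e2 = e2`. -/
noncomputable def C29s (α : ℂ) : V2 →ₗ[ℂ] V2 →ₗ[ℂ] V2 :=
  bil ![![α • e1, 0], ![0, e2]]

/-- The second multiplication of `C30^{α,β}`: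
`e1∗e1 = α e1 + β e2, e1∗e2 = e1, e2∗e1 = e1, e2∗e2 = e2`. -/
noncomputable def C30s (α β : ℂ) : V2 →ₗ[ℂ] V2 →ₗ[ℂ] V2 :=
  bil ![![α • e1 + β • e2, e1], ![e1, e2]]

/-- The second multiplication of `C31^{α,β,γ}`:
`e1∗e1 = β e1 + e2, e1∗e2 = γ e2, e2∗e1 = β e2`. -/
noncomputable def C31s (β γ : ℂ) : V2 →ₗ[ℂ] V2 →ₗ[ℂ] V2 :=
  bil ![![β • e1 + e2, γ • e2], ![β • e2, 0]]

/-- The second multiplication of `C32^{α,β,γ}`: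
`e1∗e1 = β e1, e1∗e2 = γ e2, e2∗e1 = β e2`. -/
noncomputable def C32s (β γ : ℂ) : V2 →ₗ[ℂ] V2 →ₗ[ℂ] V2 :=
  bil ![![β • e1, γ • e2], ![β • e2, 0]]

/-- The second multiplication of `C34^{α,β}`:
`e1∗e1 = α e1, e1∗e2 = α e2, e2∗e1 = α e2, e2∗e2 = e1 + β e2`. -/
noncomputable def C34s (α β : ℂ) : V2 →ₗ[ℂ] V2 →ₗ[ℂ] V2 :=
  bil ![![α • e1, α • e2], ![α • e2, e1 + β • e2]]

/-- The second multiplication of `C35^α`: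
`e1∗e1 = α e1, e1∗e2 = α e2, e2∗e1 = α e2, e2∗e2 = e2`. -/
noncomputable def C35s (α : ℂ) : V2 →ₗ[ℂ] V2 →ₗ[ℂ] V2 :=
  bil ![![α • e1, α • e2], ![α • e2, e2]]

/-- The second multiplication of `C38^{α,β,γ}`:
`e1∗e1 = (γ+β−α) e1 − β e2, e1∗e2 = α e1 + β e2, e2∗e1 = α e1 + β e2, e2∗e2 = −α e1 + γ e2`. -/
noncomputable def C38s (α β γ : ℂ) : V2 →ₗ[ℂ] V2 →ₗ[ℂ] V2 :=
  bil ![![(γ + β - α) • e1 - β • e2, α • e1 + β • e2],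
        ![α • e1 + β • e2, (-α) • e1 + γ • e2]]

/-- The second multiplication of `C39^{α,β}`: `e1∗e1 = α e1, e2∗e2 = β e2`. -/
noncomputable def C39s (α β : ℂ) : V2 →ₗ[ℂ] V2 →ₗ[ℂ] V2 :=
  bil ![![α • e1, 0], ![0, β • e2]]

/-- The second multiplication of `C40^{α,β,γ}`:
`e1∗e1 = α e1 + β e2, e1∗e2 = 2α e2, e2∗e1 = γ e1 + α e2, e2∗e2 = 2γ e2`. -/
noncomputable def C40s (α β γ : ℂ) : V2 →ₗ[ℂ] V2 →ₗ[ℂ] V2 :=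
  bil ![![α • e1 + β • e2, (2 * α) • e2], ![γ • e1 + α • e2, (2 * γ) • e2]]

/-- The second multiplication of `C41^{α,β}`:
`e1∗e1 = α e1, e1∗e2 = β e1 + 2α e2, e2∗e1 = (2β + α/2) e1 + α e2,
e2∗e2 = (β/2) e1 + (α+β) e2`. -/
noncomputable def C41s (α β : ℂ) : V2 →ₗ[ℂ] V2 →ₗ[ℂ] V2 :=
  bil ![![α • e1, β • e1 + (2 * α) • e2],
        ![(2 * β + α / 2) • e1 + α • e2, (β / 2) • e1 + (α + β) • e2]]

theorem C03_apply (x y : V2) : C03 x y = (x 0 * y 0) • e2 := by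
  simp [C03, bil, Fin.sum_univ_two]

theorem eq_smul_e1_add_smul_e2 (x : V2) : x = x 0 • e1 + x 1 • e2 := by
  ext i
  fin_cases i <;> simp [e1, e2]

/-- The automorphisms of the pre-Lie algebra `C03` (`e1·e1 = e2`) are exactly the
linear bijections with `φ(e1) = ξ e1 + ν e2`, `φ(e2) = ξ² e2` for `ξ ∈ ℂ*`, `ν ∈ ℂ`. -/
theorem automorphisms_of_C03 (φ : V2 ≃ₗ[ℂ] V2) :
    (∀ x y : V2, φ (C03 x y) = C03 (φ x) (φ y)) ↔
      ∃ ξ ν : ℂ, ξ ≠ 0 ∧ φ e1 = ξ • e1 + ν • e2 ∧ φ e2 = (ξ ^ 2) • e2 := by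
  constructor
  · intro h
    have h2 : φ e2 = (φ e1 0 ^ 2) • e2 := by
      have h11 := h e1 e1
      rw [C03_apply, C03_apply, ← pow_two (φ e1 0)] at h11
      simpa [e1] using h11
    refine ⟨φ e1 0, φ e1 1, fun h0 => ?_, eq_smul_e1_add_smul_e2 _, h2⟩
    have he2 : e2 = 0 := φ.map_eq_zero_iff.mp (by simp [h2, h0])
    simpa [e2] using congrFun he2 1
  · rintro ⟨ξ, ν, -, h1, h2⟩ x y
    have hcoord (z : V2) : φ z 0 = ξ * z 0 := by
      rw [eq_smul_e1_add_smul_e2 z, map_add, map_smul, map_smul, h1, h2]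
      simp [e1, e2, mul_comm]
    rw [C03_apply, C03_apply, map_smul, h2, hcoord, hcoord, smul_smul]
    congr 1
    ring
end
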